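/- Let A = M₂(𝔽) with 𝔽 ∈ {ℝ, ℂ, ℍ}, endowed with the operator norm, let Y be a real normed space, and let T : S_A → S_Y be a surjective isometry. Then the restriction of T to S_A ∩ A_sa admits a real linear extension; that is, there is a real linear isometry from the self-adjoint part A_sa into Y that agrees with T on S_A ∩ A_sa. -/

import Mathlib

open Matrix

/-- The operator norm of a `2 × 2` matrix over `𝔽 ∈ {ℝ, ℂ, ℍ}`, acting on the Hilbert
`𝔽`-module `𝔽²` (with the Euclidean norm). -/
noncomputable def opN (𝔽 : Type*) [NormedDivisionRing 𝔽]
    (a : Matrix (Fin 2) (Fin 2) 𝔽) : ℝ :=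
  sSup {r : ℝ | ∃ v : Fin 2 → 𝔽, ‖v 0‖ ^ 2 + ‖v 1‖ ^ 2 ≤ 1 ∧
    r = Real.sqrt (‖a.mulVec v 0‖ ^ 2 + ‖a.mulVec v 1‖ ^ 2)}

/-- For `A = M₂(𝔽)` with the operator norm: every surjective isometry `T` from the unit
sphere `S_A` onto the unit sphere of a real normed space `Y` admits a real linear extension
on the self-adjoint part `A_sa`, i.e. there is a real linear map which is isometric on
`A_sa` and agrees with `T` on `S_A ∩ A_sa`. -/
def SelfAdjointPartLinearExtension (𝔽 : Type*) [NormedDivisionRing 𝔽] [StarRing 𝔽]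
    [NormedAlgebra ℝ 𝔽] : Prop :=
  ∀ (Y : Type) [NormedAddCommGroup Y] [NormedSpace ℝ Y]
    (T : Matrix (Fin 2) (Fin 2) 𝔽 → Y),
    (∀ x y : Matrix (Fin 2) (Fin 2) 𝔽, opN 𝔽 x = 1 → opN 𝔽 y = 1 →
      ‖T x - T y‖ = opN 𝔽 (x - y)) →
    (T '' {x : Matrix (Fin 2) (Fin 2) 𝔽 | opN 𝔽 x = 1} = Metric.sphere (0 : Y) 1) →
    ∃ g : Matrix (Fin 2) (Fin 2) 𝔽 →ₗ[ℝ] Y,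
      (∀ a : Matrix (Fin 2) (Fin 2) 𝔽, aᴴ = a → ‖g a‖ = opN 𝔽 a) ∧
      (∀ a : Matrix (Fin 2) (Fin 2) 𝔽, aᴴ = a → opN 𝔽 a = 1 → g a = T a)

/-- The diagonal matrix with entries `s` and `w`. -/
def diagTwo {𝔽 : Type*} [Zero 𝔽] (s w : 𝔽) : Matrix (Fin 2) (Fin 2) 𝔽 := !![s, 0; 0, w]

theorem diagTwo_sub {𝔽 : Type*} [NormedDivisionRing 𝔽] (s w w' : 𝔽) :
    diagTwo s w - diagTwo s w' = diagTwo 0 (w - w') := by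
  ext i j
  fin_cases i <;> fin_cases j <;> simp [diagTwo]

theorem diagTwo_convex {𝔽 : Type*} [NormedDivisionRing 𝔽] [NormedSpace ℝ 𝔽] (t : ℝ) (w w' : 𝔽) :
    diagTwo 1 ((1 - t) • w + t • w') = (1 - t) • diagTwo 1 w + t • diagTwo 1 w' := by
  ext i j
  fin_cases i <;> fin_cases j <;> simp [diagTwo, ← add_smul]

theorem exists_norm_eq_one_smul {𝔽 : Type*} [NormedDivisionRing 𝔽] [NormedSpace ℝ 𝔽] (w : 𝔽) :
    ∃ v : 𝔽, ‖v‖ = 1 ∧ w = ‖w‖ • v := by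
  by_cases h0 : w = 0
  · exact ⟨1, norm_one, by simp [h0]⟩
  · exact ⟨‖w‖⁻¹ • w, norm_smul_inv_norm h0, by
      rw [smul_smul, mul_inv_cancel₀ (norm_ne_zero_iff.2 h0), one_smul]⟩

theorem inner_mul_left_mul_left {𝔽 : Type*} [NormedDivisionRing 𝔽] [InnerProductSpace ℝ 𝔽]
    (a s t : 𝔽) : inner ℝ (a * s) (a * t) = ‖a‖ ^ 2 * inner ℝ s t := by
  have h1 := norm_add_sq_real (a * s) (a * t)
  have h2 := norm_add_sq_real s t
  rw [← mul_add, norm_mul, norm_mul, norm_mul, mul_pow, mul_pow, mul_pow, h2] at h1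
  linarith

theorem inner_self_mul {𝔽 : Type*} [NormedDivisionRing 𝔽] [InnerProductSpace ℝ 𝔽] (a s : 𝔽) :
    inner ℝ s (a * s) = ‖s‖ ^ 2 * inner ℝ 1 a := by
  have h1 := norm_add_sq_real s (a * s)
  have h2 := norm_add_sq_real 1 a
  rw [← one_add_mul, norm_mul, norm_mul, mul_pow, mul_pow, h2, norm_one] at h1
  linarith

theorem norm_sq_euclidean_two {𝔽 : Type*} [NormedDivisionRing 𝔽] (v : EuclideanSpace 𝔽 (Fin 2)) :
    ‖v‖ ^ 2 = ‖v 0‖ ^ 2 + ‖v 1‖ ^ 2 := by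
  rw [PiLp.norm_sq_eq_of_L2, Fin.sum_univ_two]

section OperatorNorm

variable {𝔽 : Type*} [NormedDivisionRing 𝔽] [InnerProductSpace ℝ 𝔽] [IsScalarTower ℝ 𝔽 𝔽]
  [SMulCommClass ℝ 𝔽 𝔽] [FiniteDimensional ℝ 𝔽]

/-- A `2 × 2` matrix as a real linear operator on the Euclidean plane `𝔽²`. -/
noncomputable def matrixOp : Matrix (Fin 2) (Fin 2) 𝔽 →ₗ[ℝ]
    (EuclideanSpace 𝔽 (Fin 2) →L[ℝ] EuclideanSpace 𝔽 (Fin 2)) where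
  toFun a := LinearMap.toContinuousLinearMap
    { toFun := fun v => WithLp.toLp 2 (a.mulVec v.ofLp)
      map_add' := fun v w => by rw [WithLp.ofLp_add, Matrix.mulVec_add, WithLp.toLp_add]
      map_smul' := fun r v => by rw [WithLp.ofLp_smul, Matrix.mulVec_smul]; rfl }
  map_add' a b := by
    ext1 v
    exact congrArg (WithLp.toLp 2) (Matrix.add_mulVec a b v.ofLp)
  map_smul' r a := by
    ext1 v
    exact congrArg (WithLp.toLp 2) (Matrix.smul_mulVec r a v.ofLp)

theorem matrixOp_apply (a : Matrix (Fin 2) (Fin 2) 𝔽) (v : EuclideanSpace 𝔽 (Fin 2)) (i : Fin 2) :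
    matrixOp a v i = a i 0 * v 0 + a i 1 * v 1 :=
  Fin.sum_univ_two fun j => a i j * v j

theorem matrixOp_mul (a b : Matrix (Fin 2) (Fin 2) 𝔽) (v : EuclideanSpace 𝔽 (Fin 2)) :
    matrixOp (a * b) v = matrixOp a (matrixOp b v) :=
  congrArg (WithLp.toLp 2) (Matrix.mulVec_mulVec v.ofLp a b).symm

theorem matrixOp_injective : Function.Injective (matrixOp (𝔽 := 𝔽)) := by
  intro a b h
  ext i j
  have h0 := congrArg (fun f => f (!₂[1, 0] : EuclideanSpace 𝔽 (Fin 2)) i) h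
  have h1 := congrArg (fun f => f (!₂[0, 1] : EuclideanSpace 𝔽 (Fin 2)) i) h
  simp only [matrixOp_apply] at h0 h1
  fin_cases j
  · simpa using h0
  · simpa using h1

theorem opN_eq_norm_matrixOp (a : Matrix (Fin 2) (Fin 2) 𝔽) : opN 𝔽 a = ‖matrixOp a‖ := by
  rw [← ContinuousLinearMap.sSup_unitClosedBall_eq_norm, opN]
  congr 1
  have key (v : EuclideanSpace 𝔽 (Fin 2)) :
      ‖matrixOp a v‖ = √(‖a.mulVec v.ofLp 0‖ ^ 2 + ‖a.mulVec v.ofLp 1‖ ^ 2) := by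
    rw [← Real.sqrt_sq (norm_nonneg (matrixOp a v)), norm_sq_euclidean_two]
    rfl
  ext r
  simp only [Set.mem_ofPred_eq, Set.mem_image, Metric.mem_closedBall, dist_zero_right]
  constructor
  · rintro ⟨v, hv, rfl⟩
    refine ⟨WithLp.toLp 2 v, ?_, key _⟩
    rw [← sq_le_one_iff₀ (norm_nonneg _), norm_sq_euclidean_two]
    exact hv
  · rintro ⟨v, hv, rfl⟩
    refine ⟨v.ofLp, ?_, key v⟩
    rw [← sq_le_one_iff₀ (norm_nonneg _), norm_sq_euclidean_two] at hv
    exact hv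

/-- The operator norm on `2 × 2` matrices over `𝔽`. -/
noncomputable abbrev matrixOpNormedAddCommGroup :
    NormedAddCommGroup (Matrix (Fin 2) (Fin 2) 𝔽) :=
  NormedAddCommGroup.induced _ _ matrixOp.toAddMonoidHom matrixOp_injective

attribute [local instance] matrixOpNormedAddCommGroup

/-- The operator norm on `2 × 2` matrices over `𝔽` is a norm on a real vector space. -/
noncomputable abbrev matrixOpNormedSpace : NormedSpace ℝ (Matrix (Fin 2) (Fin 2) 𝔽) :=
  NormedSpace.induced ℝ (Matrix (Fin 2) (Fin 2) 𝔽)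
    (EuclideanSpace 𝔽 (Fin 2) →L[ℝ] EuclideanSpace 𝔽 (Fin 2)) matrixOp

attribute [local instance] matrixOpNormedSpace

theorem norm_eq_norm_matrixOp (a : Matrix (Fin 2) (Fin 2) 𝔽) : ‖a‖ = ‖matrixOp a‖ := rfl

theorem norm_matrixOp_le (a : Matrix (Fin 2) (Fin 2) 𝔽) (v : EuclideanSpace 𝔽 (Fin 2)) :
    ‖matrixOp a v‖ ≤ ‖a‖ * ‖v‖ :=
  (matrixOp a).le_opNorm v

theorem norm_le_of_matrixOp {a : Matrix (Fin 2) (Fin 2) 𝔽} {C : ℝ} (hC : 0 ≤ C)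
    (h : ∀ v, ‖matrixOp a v‖ ≤ C * ‖v‖) : ‖a‖ ≤ C :=
  (matrixOp a).opNorm_le_bound hC h

theorem exists_norm_matrixOp_eq (a : Matrix (Fin 2) (Fin 2) 𝔽) :
    ∃ v : EuclideanSpace 𝔽 (Fin 2), ‖v‖ = 1 ∧ ‖matrixOp a v‖ = ‖a‖ := by
  have hne : (Metric.sphere (0 : EuclideanSpace 𝔽 (Fin 2)) 1).Nonempty := by
    refine ⟨!₂[1, 0], ?_⟩
    rw [mem_sphere_zero_iff_norm, ← sq_eq_sq₀ (norm_nonneg _) zero_le_one, norm_sq_euclidean_two]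
    simp
  have : ProperSpace (EuclideanSpace 𝔽 (Fin 2)) := FiniteDimensional.proper ℝ _
  obtain ⟨v, hv, hmax⟩ := (isCompact_sphere (0 : EuclideanSpace 𝔽 (Fin 2)) 1).exists_isMaxOn hne
    (f := fun v => ‖matrixOp a v‖) (by fun_prop)
  rw [mem_sphere_zero_iff_norm] at hv
  refine ⟨v, hv, le_antisymm (by simpa [hv] using norm_matrixOp_le a v) ?_⟩
  refine ContinuousLinearMap.opNorm_le_of_unit_norm (norm_nonneg _) fun w hw => ?_
  exact hmax (mem_sphere_zero_iff_norm.2 hw)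

theorem norm_entry_le (a : Matrix (Fin 2) (Fin 2) 𝔽) (i j : Fin 2) : ‖a i j‖ ≤ ‖a‖ := by
  have key (v : EuclideanSpace 𝔽 (Fin 2)) (hv : ‖v 0‖ ^ 2 + ‖v 1‖ ^ 2 = 1) :
      ‖a i 0 * v 0 + a i 1 * v 1‖ ≤ ‖a‖ := by
    rw [← norm_sq_euclidean_two, pow_eq_one_iff_of_nonneg (norm_nonneg v) two_ne_zero] at hv
    rw [← matrixOp_apply]
    simpa [hv] using (PiLp.norm_apply_le _ i).trans (norm_matrixOp_le a v)
  fin_cases j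
  · simpa using key !₂[1, 0] (by simp)
  · simpa using key !₂[0, 1] (by simp)

/-- Matrices acting isometrically on `𝔽²`. -/
def IsIsometricMatrix (a : Matrix (Fin 2) (Fin 2) 𝔽) : Prop := ∀ v, ‖matrixOp a v‖ = ‖v‖

theorem norm_sq_matrixOp_diagTwo (s w : 𝔽) (v : EuclideanSpace 𝔽 (Fin 2)) :
    ‖matrixOp (diagTwo s w) v‖ ^ 2 = (‖s‖ * ‖v 0‖) ^ 2 + (‖w‖ * ‖v 1‖) ^ 2 := by
  rw [norm_sq_euclidean_two]
  simp [matrixOp_apply, diagTwo]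

theorem norm_diagTwo_le {s w : 𝔽} {C : ℝ} (hs : ‖s‖ ≤ C) (hw : ‖w‖ ≤ C) : ‖diagTwo s w‖ ≤ C := by
  have hC := (norm_nonneg s).trans hs
  refine norm_le_of_matrixOp hC fun v => ?_
  rw [← sq_le_sq₀ (norm_nonneg _) (by positivity), norm_sq_matrixOp_diagTwo, mul_pow C,
    norm_sq_euclidean_two, mul_add, ← mul_pow, ← mul_pow]
  gcongr

theorem norm_diagTwo_one {w : 𝔽} (hw : ‖w‖ ≤ 1) : ‖diagTwo 1 w‖ = 1 :=
  le_antisymm (norm_diagTwo_le (by simp) hw)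
    (by simpa [diagTwo] using norm_entry_le (diagTwo 1 w) 0 0)

theorem norm_diagTwo_zero (w : 𝔽) : ‖diagTwo 0 w‖ = ‖w‖ :=
  le_antisymm (norm_diagTwo_le (by simp) le_rfl)
    (by simpa [diagTwo] using norm_entry_le (diagTwo 0 w) 1 1)

theorem isIsometricMatrix_diagTwo {s w : 𝔽} (hs : ‖s‖ = 1) (hw : ‖w‖ = 1) :
    IsIsometricMatrix (diagTwo s w) := fun v => by
  rw [← sq_eq_sq₀ (norm_nonneg _) (norm_nonneg _), norm_sq_matrixOp_diagTwo,
    norm_sq_euclidean_two, hs, hw, one_mul, one_mul]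

theorem eq_diagTwo_of_entry_eq_one {b : Matrix (Fin 2) (Fin 2) 𝔽} (hb : ‖b‖ ≤ 1)
    (h : b 0 0 = 1) : b = diagTwo 1 (b 1 1) := by
  have key (v : EuclideanSpace 𝔽 (Fin 2)) : ‖b 0 0 * v 0 + b 0 1 * v 1‖ ^ 2 +
      ‖b 1 0 * v 0 + b 1 1 * v 1‖ ^ 2 ≤ ‖v 0‖ ^ 2 + ‖v 1‖ ^ 2 := by
    rw [← matrixOp_apply, ← matrixOp_apply, ← norm_sq_euclidean_two, ← norm_sq_euclidean_two]
    exact pow_le_pow_left₀ (norm_nonneg _)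
      ((norm_matrixOp_le b v).trans (mul_le_of_le_one_left (norm_nonneg _) hb)) 2
  have h10 : b 1 0 = 0 := by
    have := key !₂[1, 0]
    simp [h] at this
    exact this
  have h01 : b 0 1 = 0 := by
    by_contra hne
    have hpos : 0 < ‖b 0 1‖ := norm_pos_iff.2 hne
    have h1 := key !₂[1, (‖b 0 1‖ ^ 2) • (b 0 1)⁻¹]
    have h2 : ‖(1 : 𝔽) + ‖b 0 1‖ ^ 2 • (1 : 𝔽)‖ = 1 + ‖b 0 1‖ ^ 2 := by
      rw [← one_smul ℝ (1 : 𝔽), smul_smul, ← add_smul, norm_smul]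
      simp
      positivity
    simp [h, h10, hne, mul_smul_comm, h2, norm_smul] at h1
    have h3 : (‖b 0 1‖ ^ 2 * ‖b 0 1‖⁻¹) = ‖b 0 1‖ := by field_simp
    rw [h3] at h1
    nlinarith [sq_nonneg (‖b 1 1‖ * ‖b 0 1‖), sq_nonneg ‖b 0 1‖, pow_pos hpos 2]
  ext i j
  fin_cases i <;> fin_cases j <;> simp [diagTwo, h, h10, h01]

theorem entry_eq_one_of_norm_add_eq_two {w : 𝔽} (hw : ‖w‖ < 1) {b : Matrix (Fin 2) (Fin 2) 𝔽}
    (hb : ‖b‖ = 1) (h : ‖diagTwo 1 w + b‖ = 2) : b 0 0 = 1 := by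
  obtain ⟨v, hv, hn⟩ := exists_norm_matrixOp_eq (diagTwo 1 w + b)
  rw [h, map_add, _root_.add_apply] at hn
  have hp := norm_matrixOp_le (diagTwo 1 w) v
  have hq := norm_matrixOp_le b v
  rw [norm_diagTwo_one hw.le, hv] at hp
  rw [hb, hv] at hq
  have hle := norm_add_le (matrixOp (diagTwo 1 w) v) (matrixOp b v)
  have hp1 : ‖matrixOp (diagTwo 1 w) v‖ = 1 := by linarith
  have hq1 : ‖matrixOp b v‖ = 1 := by linarith
  have heq : matrixOp (diagTwo 1 w) v = matrixOp b v := by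
    rw [← sub_eq_zero, ← norm_eq_zero, ← sq_eq_zero_iff]
    have := parallelogram_law_with_norm ℝ (matrixOp (diagTwo 1 w) v) (matrixOp b v)
    rw [hn, hp1, hq1] at this
    linarith
  have hsq := norm_sq_matrixOp_diagTwo 1 w v
  have hvsq := norm_sq_euclidean_two v
  rw [hp1] at hsq
  rw [hv] at hvsq
  have hv1 : v 1 = 0 := by
    by_contra hne
    have : 0 < ‖v 1‖ := norm_pos_iff.2 hne
    have : ‖w‖ * ‖v 1‖ < ‖v 1‖ := by nlinarith
    have : (‖w‖ * ‖v 1‖) ^ 2 < ‖v 1‖ ^ 2 := pow_lt_pow_left₀ this (by positivity) two_ne_zero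
    simp at hsq
    linarith
  have hv0 : v 0 ≠ 0 := by
    rintro h0
    simp [h0, hv1] at hvsq
  have h0 := congrArg (fun x : EuclideanSpace 𝔽 (Fin 2) => x 0) heq
  simp only [matrixOp_apply, hv1] at h0
  simp [diagTwo] at h0
  exact (mul_eq_right₀ hv0).1 h0.symm

theorem exists_isIsometricMatrix_column {η : EuclideanSpace 𝔽 (Fin 2)} (hη : ‖η‖ = 1) :
    ∃ U : Matrix (Fin 2) (Fin 2) 𝔽, IsIsometricMatrix U ∧ U 0 0 = η 0 ∧ U 1 0 = η 1 := by
  have hsq := norm_sq_euclidean_two η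
  rw [hη, one_pow] at hsq
  suffices ∃ x y : 𝔽, ∀ s t : 𝔽,
      ‖η 0 * s + x * t‖ ^ 2 + ‖η 1 * s + y * t‖ ^ 2 = ‖s‖ ^ 2 + ‖t‖ ^ 2 by
    obtain ⟨x, y, h⟩ := this
    refine ⟨!![η 0, x; η 1, y], fun v => ?_, rfl, rfl⟩
    rw [← sq_eq_sq₀ (norm_nonneg _) (norm_nonneg _), norm_sq_euclidean_two,
      norm_sq_euclidean_two, matrixOp_apply, matrixOp_apply]
    exact h (v 0) (v 1)
  by_cases h0 : η 0 = 0
  · refine ⟨1, 0, fun s t => ?_⟩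
    rw [h0, norm_zero] at hsq
    simp only [h0, zero_mul, zero_add, one_mul, add_zero, norm_mul, mul_pow]
    nlinarith
  by_cases h1 : η 1 = 0
  · refine ⟨0, 1, fun s t => ?_⟩
    rw [h1, norm_zero] at hsq
    simp only [h1, zero_mul, zero_add, one_mul, add_zero, norm_mul, mul_pow]
    nlinarith
  have p0 : ‖η 0‖ ≠ 0 := norm_ne_zero_iff.2 h0
  have p1 : ‖η 1‖ ≠ 0 := norm_ne_zero_iff.2 h1
  refine ⟨(‖η 1‖ / ‖η 0‖) • η 0, (-(‖η 0‖ / ‖η 1‖)) • η 1, fun s t => ?_⟩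
  rw [norm_add_sq_real, norm_add_sq_real, smul_mul_assoc, smul_mul_assoc, real_inner_smul_right,
    real_inner_smul_right, inner_mul_left_mul_left, inner_mul_left_mul_left, norm_smul, norm_smul,
    norm_mul, norm_mul, norm_mul, norm_mul, norm_neg, norm_div, norm_div, norm_norm, norm_norm]
  field_simp
  linear_combination -(‖s‖ ^ 2 + ‖t‖ ^ 2) * hsq

theorem IsIsometricMatrix.norm_mul_left {W : Matrix (Fin 2) (Fin 2) 𝔽} (hW : IsIsometricMatrix W)
    (x : Matrix (Fin 2) (Fin 2) 𝔽) : ‖W * x‖ = ‖x‖ := by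
  refine le_antisymm (norm_le_of_matrixOp (norm_nonneg _) fun v => ?_)
    (norm_le_of_matrixOp (norm_nonneg _) fun v => ?_)
  · rw [matrixOp_mul, hW]
    exact norm_matrixOp_le x v
  · rw [← hW, ← matrixOp_mul]
    exact norm_matrixOp_le _ v

theorem IsIsometricMatrix.surjective {U : Matrix (Fin 2) (Fin 2) 𝔽} (hU : IsIsometricMatrix U) :
    Function.Surjective (matrixOp U) := by
  have hinj : Function.Injective (matrixOp U).toLinearMap :=
    (injective_iff_map_eq_zero _).2 fun v hv => by
      rw [← norm_eq_zero, ← hU v]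
      exact norm_eq_zero.2 hv
  exact LinearMap.injective_iff_surjective.1 hinj

theorem IsIsometricMatrix.norm_mul_right {U : Matrix (Fin 2) (Fin 2) 𝔽} (hU : IsIsometricMatrix U)
    (x : Matrix (Fin 2) (Fin 2) 𝔽) : ‖x * U‖ = ‖x‖ := by
  refine le_antisymm (norm_le_of_matrixOp (norm_nonneg _) fun v => ?_)
    (norm_le_of_matrixOp (norm_nonneg _) fun v => ?_)
  · rw [matrixOp_mul, ← hU v]
    exact norm_matrixOp_le x _
  · obtain ⟨w, rfl⟩ := hU.surjective v
    rw [← matrixOp_mul, hU]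
    exact norm_matrixOp_le _ w

/-- Left multiplication by an isometric matrix. -/
noncomputable def IsIsometricMatrix.mulLeft {W : Matrix (Fin 2) (Fin 2) 𝔽}
    (hW : IsIsometricMatrix W) : Matrix (Fin 2) (Fin 2) 𝔽 ≃ₗᵢ[ℝ] Matrix (Fin 2) (Fin 2) 𝔽 :=
  LinearIsometry.toLinearIsometryEquiv ⟨LinearMap.mulLeft ℝ W, hW.norm_mul_left⟩ rfl

/-- Right multiplication by an isometric matrix. -/
noncomputable def IsIsometricMatrix.mulRight {U : Matrix (Fin 2) (Fin 2) 𝔽}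
    (hU : IsIsometricMatrix U) : Matrix (Fin 2) (Fin 2) 𝔽 ≃ₗᵢ[ℝ] Matrix (Fin 2) (Fin 2) 𝔽 :=
  LinearIsometry.toLinearIsometryEquiv ⟨LinearMap.mulRight ℝ U, hU.norm_mul_right⟩ rfl

/-- Up to an isometry of `M₂(𝔽)`, the face of contractions sending `η` to `ξ` is the face of
matrices `diagTwo 1 w`. -/
theorem exists_face_equiv {η ξ : EuclideanSpace 𝔽 (Fin 2)} (hη : ‖η‖ = 1) (hξ : ‖ξ‖ = 1) :
    ∃ Φ : Matrix (Fin 2) (Fin 2) 𝔽 ≃ₗᵢ[ℝ] Matrix (Fin 2) (Fin 2) 𝔽,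
      (∀ x, ‖x‖ = 1 → matrixOp x η = ξ → ∃ w, ‖w‖ ≤ 1 ∧ Φ (diagTwo 1 w) = x) ∧
      ∀ z, IsIsometricMatrix z → IsIsometricMatrix (Φ z) := by
  obtain ⟨U, hU, hU0, hU1⟩ := exists_isIsometricMatrix_column hη
  obtain ⟨W, hW, hW0, hW1⟩ := exists_isIsometricMatrix_column hξ
  have col {V : Matrix (Fin 2) (Fin 2) 𝔽} {ζ : EuclideanSpace 𝔽 (Fin 2)} (h0 : V 0 0 = ζ 0)
      (h1 : V 1 0 = ζ 1) : matrixOp V !₂[1, 0] = ζ := by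
    ext i
    rw [matrixOp_apply]
    fin_cases i <;> simp [h0, h1]
  have hΦ (y : Matrix (Fin 2) (Fin 2) 𝔽) :
      (hU.mulRight.symm.trans hW.mulLeft) (hU.mulRight y) = W * y :=
    congrArg hW.mulLeft (hU.mulRight.symm_apply_apply y)
  refine ⟨hU.mulRight.symm.trans hW.mulLeft, fun x hx hxη => ?_, fun z hz => ?_⟩
  · obtain ⟨y, rfl⟩ := (hU.mulRight.symm.trans hW.mulLeft).surjective x
    rw [LinearIsometryEquiv.norm_map] at hx
    obtain ⟨y, rfl⟩ := hU.mulRight.surjective y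
    rw [hΦ] at hxη
    change ‖y * U‖ = 1 at hx
    have h00 : (y * U) 0 0 = 1 := by
      have : matrixOp (y * U) !₂[1, 0] = !₂[1, 0] := by
        rw [matrixOp_mul, col hU0 hU1, ← sub_eq_zero, ← norm_eq_zero, ← hW, map_sub,
          ← matrixOp_mul, hxη, col hW0 hW1, sub_self, norm_zero]
      have := congrArg (fun v : EuclideanSpace 𝔽 (Fin 2) => v 0) this
      simp only [matrixOp_apply] at this
      simpa using this
    refine ⟨(y * U) 1 1, (norm_entry_le _ 1 1).trans hx.le, ?_⟩
    rw [← eq_diagTwo_of_entry_eq_one hx.le h00]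
    rfl
  · obtain ⟨y, rfl⟩ := hU.mulRight.surjective z
    intro v
    obtain ⟨v, rfl⟩ := hU.surjective v
    rw [hΦ, matrixOp_mul, hW, ← matrixOp_mul, hU]
    exact hz v

theorem exists_face_equiv_of_norm_eq_one {x : Matrix (Fin 2) (Fin 2) 𝔽} (hx : ‖x‖ = 1) :
    ∃ Φ : Matrix (Fin 2) (Fin 2) 𝔽 ≃ₗᵢ[ℝ] Matrix (Fin 2) (Fin 2) 𝔽,
      (∃ w, ‖w‖ ≤ 1 ∧ Φ (diagTwo 1 w) = x) ∧
      ∀ z, IsIsometricMatrix z → IsIsometricMatrix (Φ z) := by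
  obtain ⟨η, hη, hxη⟩ := exists_norm_matrixOp_eq x
  obtain ⟨Φ, h1, h2⟩ := exists_face_equiv hη (hxη.trans hx)
  exact ⟨Φ, h1 x hx rfl, h2⟩

theorem exists_equiv_diagTwo_swap {v : 𝔽} (hv : ‖v‖ = 1) :
    ∃ Φ : Matrix (Fin 2) (Fin 2) 𝔽 ≃ₗᵢ[ℝ] Matrix (Fin 2) (Fin 2) 𝔽,
      ∀ w, Φ (diagTwo 1 w) = diagTwo w v := by
  have h (u : 𝔽) (hu : ‖u‖ = 1) : IsIsometricMatrix !![0, 1; u, 0] := fun x => by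
    rw [← sq_eq_sq₀ (norm_nonneg _) (norm_nonneg _), norm_sq_euclidean_two,
      norm_sq_euclidean_two, matrixOp_apply, matrixOp_apply]
    simp [hu, add_comm]
  refine ⟨(h 1 norm_one).mulRight.trans (h v hv).mulLeft, fun w => ?_⟩
  change !![0, 1; v, 0] * (diagTwo 1 w * !![0, 1; 1, 0]) = _
  simp [diagTwo]

theorem IsIsometricMatrix.norm_eq_one {z : Matrix (Fin 2) (Fin 2) 𝔽} (hz : IsIsometricMatrix z) :
    ‖z‖ = 1 := by
  obtain ⟨v, hv, h⟩ := exists_norm_matrixOp_eq z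
  rw [← h, hz, hv]

/-- An isometric matrix `z` with `z 0 0 ≠ -1` agrees at some unit vector with a diagonal isometric
matrix whose first entry is `-1`. -/
theorem IsIsometricMatrix.exists_common_vector {z : Matrix (Fin 2) (Fin 2) 𝔽}
    (hz : IsIsometricMatrix z) (h : z 0 0 ≠ -1) :
    ∃ ω : 𝔽, ‖ω‖ = 1 ∧ ∃ η : EuclideanSpace 𝔽 (Fin 2), ‖η‖ = 1 ∧
      matrixOp (diagTwo (-1) ω) η = matrixOp z η := by
  have hne : 1 + z 0 0 ≠ 0 := fun h0 => h (eq_neg_of_add_eq_zero_right h0)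
  set ζ : EuclideanSpace 𝔽 (Fin 2) := !₂[-((1 + z 0 0)⁻¹ * z 0 1), 1] with hζ
  have hz0 : matrixOp z ζ 0 = -ζ 0 := by
    have : (1 + z 0 0) * ζ 0 + z 0 1 = 0 := by
      simp [hζ, mul_inv_cancel_left₀ hne]
    rw [matrixOp_apply, eq_neg_iff_add_eq_zero, ← this]
    simp only [hζ, PiLp.toLp_apply, cons_val_one, cons_val_fin_one, mul_one]
    noncomm_ring
  have hω : ‖matrixOp z ζ 1‖ = 1 := by
    have h1 := norm_sq_euclidean_two (matrixOp z ζ)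
    rw [hz, norm_sq_euclidean_two, hz0, norm_neg] at h1
    have h2 : ‖ζ 1‖ = 1 := by simp [hζ]
    rw [h2] at h1
    rw [← sq_eq_sq₀ (norm_nonneg _) zero_le_one]
    linarith
  have hζ0 : ζ ≠ 0 := by
    intro h0
    have := congrArg (fun v : EuclideanSpace 𝔽 (Fin 2) => v 1) h0
    simp [hζ] at this
  refine ⟨matrixOp z ζ 1, hω, ‖ζ‖⁻¹ • ζ, norm_smul_inv_norm hζ0, ?_⟩
  rw [map_smul, map_smul]
  congr 1
  ext i
  rw [matrixOp_apply]
  fin_cases i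
  · simp [diagTwo, hz0]
  · simp [diagTwo, hζ]

theorem IsIsometricMatrix.norm_sq_smul_sub_le {z : Matrix (Fin 2) (Fin 2) 𝔽}
    (hz : IsIsometricMatrix z) {k t : ℝ} (ht : 0 ≤ t) (htk : 4 * t ≤ k) :
    ‖k • diagTwo 1 0 - t • z‖ ^ 2 ≤ (k - t * inner ℝ 1 (z 0 0)) ^ 2 + 3 * t ^ 2 := by
  set α : ℝ := inner ℝ 1 (z 0 0) with hα
  have hα1 : |α| ≤ 1 := by
    have := abs_real_inner_le_norm 1 (z 0 0)
    rw [norm_one, one_mul] at this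
    exact this.trans ((norm_entry_le z 0 0).trans hz.norm_eq_one.le)
  obtain ⟨v, hv, hn⟩ := exists_norm_matrixOp_eq (k • diagTwo 1 0 - t • z)
  have hvsq := norm_sq_euclidean_two v
  rw [hv] at hvsq
  have hinner : inner ℝ (matrixOp (diagTwo 1 0) v) (matrixOp z v) =
      ‖v 0‖ ^ 2 * α + inner ℝ (v 0) (z 0 1 * v 1) := by
    rw [PiLp.inner_apply, Fin.sum_univ_two]
    simp only [matrixOp_apply]
    simp [diagTwo, inner_add_right, inner_self_mul, hα]
  have hcs : |inner ℝ (v 0) (z 0 1 * v 1)| ≤ ‖v 0‖ * ‖v 1‖ := by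
    refine (abs_real_inner_le_norm _ _).trans ?_
    rw [norm_mul]
    gcongr
    exact mul_le_of_le_one_left (norm_nonneg _) ((norm_entry_le z 0 1).trans hz.norm_eq_one.le)
  have hd := norm_sq_matrixOp_diagTwo 1 0 v
  rw [← hn, map_sub, map_smul, map_smul, _root_.sub_apply, _root_.smul_apply, _root_.smul_apply,
    norm_sub_sq_real, real_inner_smul_left, real_inner_smul_right, hinner, norm_smul, norm_smul,
    mul_pow, mul_pow, hd, hz, hv]
  simp only [norm_one, norm_zero, one_mul, zero_mul, Real.norm_eq_abs, sq_abs]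
  generalize ‖v 0‖ = p at *
  generalize ‖v 1‖ = q at *
  generalize inner ℝ (v 0) (z 0 1 * v 1) = c at *
  have h1 := (abs_le.1 hcs).1
  have h2 := (abs_le.1 hα1)
  have hk : 0 ≤ k := by linarith
  have h3 : k * t * (-c) ≤ k * t * (p * q) :=
    mul_le_mul_of_nonneg_left (by linarith) (by positivity)
  have h4 : 0 ≤ (k ^ 2 - 4 * k * t * α) * q ^ 2 := by
    have : 0 ≤ k * (k - 4 * t * α) := mul_nonneg hk (by nlinarith)
    nlinarith [sq_nonneg q]
  have hp : p ^ 2 = 1 - q ^ 2 := by linarith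
  nlinarith [sq_nonneg (k * q - 2 * t * p), sq_nonneg (t * α), sq_nonneg (t * q)]

theorem norm_diagTwo_add {w w' : 𝔽} (hw : ‖w‖ ≤ 1) (hw' : ‖w'‖ ≤ 1) :
    ‖diagTwo 1 w + diagTwo 1 w'‖ = 2 := by
  refine le_antisymm ((norm_add_le _ _).trans ?_) ?_
  · rw [norm_diagTwo_one hw, norm_diagTwo_one hw']
    norm_num
  · have h := norm_entry_le (diagTwo 1 w + diagTwo 1 w') 0 0
    have h2 : ‖(1 : 𝔽) + 1‖ = 2 := by
      rw [← two_smul ℝ (1 : 𝔽), norm_smul]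
      simp
    simpa [diagTwo, h2] using h

/-- `T` restricts to a surjective isometry between the unit spheres of `X` and `Y`. -/
structure IsSphereIsometry {X Y : Type*} [NormedAddCommGroup X] [NormedAddCommGroup Y]
    (T : X → Y) : Prop where
  norm_sub : ∀ x y, ‖x‖ = 1 → ‖y‖ = 1 → ‖T x - T y‖ = ‖x - y‖
  norm_map : ∀ x, ‖x‖ = 1 → ‖T x‖ = 1
  surj : ∀ y, ‖y‖ = 1 → ∃ x, ‖x‖ = 1 ∧ T x = y

namespace IsSphereIsometry

theorem comp_equiv {X Y : Type*} [NormedAddCommGroup X] [NormedAddCommGroup Y] [NormedSpace ℝ X]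
    {T : X → Y} (hT : IsSphereIsometry T) (Φ : X ≃ₗᵢ[ℝ] X) :
    IsSphereIsometry (T ∘ Φ) where
  norm_sub x y hx hy := by
    simp only [Function.comp_apply]
    rw [hT.norm_sub _ _ (by simpa) (by simpa), ← map_sub, Φ.norm_map]
  norm_map x hx := hT.norm_map _ (by simpa)
  surj y hy := by
    obtain ⟨x, hx, rfl⟩ := hT.surj y hy
    exact ⟨Φ.symm x, by simpa, by simp⟩

variable {Y : Type*} [NormedAddCommGroup Y] {T : Matrix (Fin 2) (Fin 2) 𝔽 → Y}

theorem exists_antipode (hT : IsSphereIsometry T) {x : Matrix (Fin 2) (Fin 2) 𝔽} (hx : ‖x‖ = 1) :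
    ∃ y, ‖y‖ = 1 ∧ T y = -T x :=
  hT.surj _ (by rw [norm_neg, hT.norm_map x hx])

variable [NormedSpace ℝ Y]

/-- A point mapped to the antipode of a point of the face `{diagTwo 1 w}` lies in the opposite
face. -/
theorem antipode_mem_neg_face (hT : IsSphereIsometry T) {w : 𝔽} (hw : ‖w‖ ≤ 1)
    {y : Matrix (Fin 2) (Fin 2) 𝔽} (hy : ‖y‖ = 1) (h : T y = -T (diagTwo 1 w)) :
    y = -diagTwo 1 (-y 1 1) := by
  have interior {w : 𝔽} (hw : ‖w‖ < 1) {y : Matrix (Fin 2) (Fin 2) 𝔽} (hy : ‖y‖ = 1)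
      (h : T y = -T (diagTwo 1 w)) : y 0 0 = -1 := by
    have hn := hT.norm_sub _ _ (norm_diagTwo_one hw.le) hy
    rw [h, sub_neg_eq_add, ← two_smul ℝ, norm_smul, hT.norm_map _ (norm_diagTwo_one hw.le),
      sub_eq_add_neg] at hn
    have := entry_eq_one_of_norm_add_eq_two hw (b := -y) (by rwa [norm_neg])
      (by rw [← hn]; norm_num)
    rw [← this, Matrix.neg_apply, neg_neg]
  have h00 : (-y) 0 0 = 1 := by
    have key : ∀ ε : ℝ, 0 < ε → ‖y 0 0 + 1‖ ≤ 0 + ε := fun ε hε => by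
      obtain ⟨r, hr0, hr1, hrε⟩ : ∃ r : ℝ, 0 ≤ r ∧ r < 1 ∧ 1 - r ≤ ε :=
        ⟨max 0 (1 - ε), le_max_left _ _, max_lt one_pos (by linarith),
          by linarith [le_max_right 0 (1 - ε)]⟩
      have hrw : ‖r • w‖ < 1 := by
        rw [norm_smul, Real.norm_of_nonneg hr0]
        nlinarith
      obtain ⟨y', hy', hTy'⟩ := hT.exists_antipode (norm_diagTwo_one hrw.le)
      have h1 := norm_entry_le (y - y') 0 0
      rw [← hT.norm_sub _ _ hy hy', h, hTy', ← neg_sub', norm_neg, hT.norm_sub _ _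
        (norm_diagTwo_one hw) (norm_diagTwo_one hrw.le), diagTwo_sub, norm_diagTwo_zero,
        Matrix.sub_apply, interior hrw hy' hTy', sub_neg_eq_add] at h1
      refine h1.trans ?_
      have : w - r • w = (1 - r) • w := by rw [sub_smul, one_smul]
      rw [this, norm_smul, Real.norm_of_nonneg (by linarith), zero_add]
      nlinarith [norm_nonneg w]
    have h0 := norm_le_zero_iff.1 (le_of_forall_pos_le_add key)
    rw [Matrix.neg_apply, eq_neg_of_add_eq_zero_left h0, neg_neg]
  have := eq_diagTwo_of_entry_eq_one (by rw [norm_neg]; exact hy.le) h00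
  rw [← neg_eq_iff_eq_neg, this]
  simp [diagTwo]

theorem map_neg_diagTwo_of_norm_eq_one (hT : IsSphereIsometry T) {v : 𝔽} (hv : ‖v‖ = 1) :
    T (-diagTwo 1 v) = -T (diagTwo 1 v) := by
  obtain ⟨y, hy, hTy⟩ := hT.exists_antipode (norm_diagTwo_one hv.le)
  obtain ⟨Φ, hΦ⟩ := exists_equiv_diagTwo_swap hv
  have h1 := hT.antipode_mem_neg_face hv.le hy hTy
  have h2 := (hT.comp_equiv Φ).antipode_mem_neg_face (w := 1) (y := Φ.symm y) (by simp)
    (by simpa) (by simpa [hΦ])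
  have h3 := congrArg Φ h2
  rw [Φ.apply_symm_apply, map_neg, hΦ] at h3
  have h11 := congrFun (congrFun h3 1) 1
  rw [← hTy, h1, h11]
  simp [diagTwo]

theorem map_neg_diagTwo (hT : IsSphereIsometry T) {w : 𝔽} (hw : ‖w‖ ≤ 1) :
    T (-diagTwo 1 w) = -T (diagTwo 1 w) := by
  obtain ⟨y, hy, hTy⟩ := hT.exists_antipode (norm_diagTwo_one hw)
  have h1 := hT.antipode_mem_neg_face hw hy hTy
  set u := -y 1 1
  have hu : ‖u‖ ≤ 1 := by
    rw [norm_neg]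
    exact (norm_entry_le y 1 1).trans hy.le
  have hdist (v : 𝔽) (hv : ‖v‖ = 1) : ‖u - v‖ = ‖w - v‖ := by
    have h := hT.norm_sub y (-diagTwo 1 v) hy (by rw [norm_neg, norm_diagTwo_one hv.le])
    rw [hTy, hT.map_neg_diagTwo_of_norm_eq_one hv, ← neg_sub', norm_neg,
      hT.norm_sub _ _ (norm_diagTwo_one hw) (norm_diagTwo_one hv.le), h1, ← neg_sub', norm_neg,
      diagTwo_sub, diagTwo_sub, norm_diagTwo_zero, norm_diagTwo_zero] at h
    exact h.symm
  obtain ⟨v, hv, hwv⟩ := exists_norm_eq_one_smul w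
  have huw : u = w := by
    have e1 := congrArg (· ^ 2) (hdist v hv)
    have e2 := congrArg (· ^ 2) (hdist (-v) (by rwa [norm_neg]))
    simp only [norm_sub_sq_real, inner_neg_right, norm_neg, hv] at e1 e2
    rw [← sub_eq_zero, ← norm_eq_zero, ← sq_eq_zero_iff, norm_sub_sq_real]
    have e3 : inner ℝ u w = ‖w‖ * inner ℝ u v := by
      nth_rewrite 1 [hwv]
      rw [real_inner_smul_right]
    have e4 : ‖w‖ ^ 2 = ‖w‖ * inner ℝ w v := by
      rw [← real_inner_self_eq_norm_sq]
      nth_rewrite 2 [hwv]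
      rw [real_inner_smul_right]
    have e5 : inner ℝ u v = inner ℝ w v := by linarith
    rw [e3, e5, ← e4]
    linarith
  rw [← hTy, h1, huw]

theorem map_neg (hT : IsSphereIsometry T) {x : Matrix (Fin 2) (Fin 2) 𝔽} (hx : ‖x‖ = 1) :
    T (-x) = -T x := by
  obtain ⟨Φ, ⟨w, hw, rfl⟩, -⟩ := exists_face_equiv_of_norm_eq_one hx
  simpa using (hT.comp_equiv Φ).map_neg_diagTwo hw

theorem norm_add (hT : IsSphereIsometry T) {x y : Matrix (Fin 2) (Fin 2) 𝔽} (hx : ‖x‖ = 1)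
    (hy : ‖y‖ = 1) : ‖T x + T y‖ = ‖x + y‖ := by
  rw [← sub_neg_eq_add, ← hT.map_neg hy, hT.norm_sub _ _ hx (by rwa [norm_neg]), sub_neg_eq_add]

/-- `T` is affine on the face `{diagTwo 1 w}`. -/
theorem map_diagTwo_convex (hT : IsSphereIsometry T) {w w' : 𝔽} (hw : ‖w‖ ≤ 1) (hw' : ‖w'‖ ≤ 1)
    {t : ℝ} (ht0 : 0 ≤ t) (ht1 : t ≤ 1) :
    T (diagTwo 1 ((1 - t) • w + t • w')) =
      (1 - t) • T (diagTwo 1 w) + t • T (diagTwo 1 w') := by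
  have convex_le {w w' : 𝔽} (hw : ‖w‖ ≤ 1) (hw' : ‖w'‖ ≤ 1) : ‖(1 - t) • w + t • w'‖ ≤ 1 := by
    refine (norm_add_le _ _).trans ?_
    rw [norm_smul, norm_smul, Real.norm_of_nonneg ht0, Real.norm_of_nonneg (by linarith)]
    nlinarith
  have interior {w w' : 𝔽} (hw : ‖w‖ < 1) (hw' : ‖w'‖ ≤ 1) :
      T (diagTwo 1 ((1 - t) • w + t • w')) =
        (1 - t) • T (diagTwo 1 w) + t • T (diagTwo 1 w') := by
    set a := T (diagTwo 1 w) with ha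
    set b := T (diagTwo 1 w') with hb
    have hna : ‖a‖ = 1 := hT.norm_map _ (norm_diagTwo_one hw.le)
    have hnb : ‖b‖ = 1 := hT.norm_map _ (norm_diagTwo_one hw')
    have hab : ‖a + b‖ = 2 := by
      rw [ha, hb, hT.norm_add (norm_diagTwo_one hw.le) (norm_diagTwo_one hw'),
        norm_diagTwo_add hw.le hw']
    have hsum {p q : ℝ} (hp : 0 ≤ p) (hq : 0 ≤ q) : ‖p • a + q • b‖ = p + q := by
      refine le_antisymm ((norm_add_le _ _).trans ?_) ?_
      · rw [norm_smul, norm_smul, hna, hnb, Real.norm_of_nonneg hp, Real.norm_of_nonneg hq]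
        simp
      · have h1 : (p + q) • (a + b) = (p • a + q • b) + (q • a + p • b) := by module
        have h2 : ‖q • a + p • b‖ ≤ q + p := (norm_add_le _ _).trans (by
          rw [norm_smul, norm_smul, hna, hnb, Real.norm_of_nonneg hp, Real.norm_of_nonneg hq]
          simp)
        have h3 := norm_add_le (p • a + q • b) (q • a + p • b)
        rw [← h1, norm_smul, hab, Real.norm_of_nonneg (by positivity)] at h3
        linarith
    obtain ⟨c, hc, hTc⟩ := hT.surj ((1 - t) • a + t • b)
      (by rw [hsum (by linarith) ht0]; ring)
    have hac : ‖diagTwo 1 w + c‖ = 2 := by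
      rw [← hT.norm_add (norm_diagTwo_one hw.le) hc, hTc, ← ha]
      have : a + ((1 - t) • a + t • b) = (2 - t) • a + t • b := by module
      rw [this, hsum (by linarith) ht0]
      ring
    have hcd := eq_diagTwo_of_entry_eq_one hc.le (entry_eq_one_of_norm_add_eq_two hw hc hac)
    set u := c 1 1
    have hu : ‖u‖ ≤ 1 := (norm_entry_le c 1 1).trans hc.le
    have hd {w₁ w₂ : 𝔽} (h₁ : ‖w₁‖ ≤ 1) (h₂ : ‖w₂‖ ≤ 1) :
        ‖T (diagTwo 1 w₁) - T (diagTwo 1 w₂)‖ = ‖w₁ - w₂‖ := by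
      rw [hT.norm_sub _ _ (norm_diagTwo_one h₁) (norm_diagTwo_one h₂), diagTwo_sub,
        norm_diagTwo_zero]
    have hwu : ‖u - w‖ = t * ‖w' - w‖ := by
      rw [← hd hu hw.le, ← hd hw' hw.le, ← hcd, hTc, ← ha, ← hb]
      have : (1 - t) • a + t • b - a = t • (b - a) := by module
      rw [this, norm_smul, Real.norm_of_nonneg ht0]
    have hwu' : ‖u - w'‖ = (1 - t) * ‖w' - w‖ := by
      rw [← hd hu hw', ← hd hw' hw.le, ← hcd, hTc, ← ha, ← hb]
      have : (1 - t) • a + t • b - b = (t - 1) • (b - a) := by module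
      rw [this, norm_smul, ← norm_neg, Real.norm_of_nonneg (by linarith), neg_sub]
    have huv : u = (1 - t) • w + t • w' := by
      have h2 : u - w' = (u - w) - (w' - w) := by abel
      have e : ‖u - w'‖ ^ 2 = ((1 - t) * ‖w' - w‖) ^ 2 := by rw [hwu']
      rw [h2, norm_sub_sq_real, hwu] at e
      have h3 : u - ((1 - t) • w + t • w') = (u - w) - t • (w' - w) := by module
      rw [← sub_eq_zero, ← norm_eq_zero, ← sq_eq_zero_iff, h3, norm_sub_sq_real, norm_smul,
        real_inner_smul_right, hwu, Real.norm_of_nonneg ht0]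
      linear_combination t * e
    rw [← hTc, hcd, huv]
  rw [← sub_eq_zero, ← norm_le_zero_iff]
  refine le_of_forall_pos_le_add fun ε hε => ?_
  obtain ⟨r, hr0, hr1, hrε⟩ : ∃ r : ℝ, 0 ≤ r ∧ r < 1 ∧ 2 * (1 - r) ≤ ε :=
    ⟨max 0 (1 - ε / 2), le_max_left _ _, max_lt one_pos (by linarith),
      by linarith [le_max_right 0 (1 - ε / 2)]⟩
  have hrw : ‖r • w‖ < 1 := by
    rw [norm_smul, Real.norm_of_nonneg hr0]
    nlinarith
  have hwr : ‖w - r • w‖ ≤ 1 - r := by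
    have : w - r • w = (1 - r) • w := by rw [sub_smul, one_smul]
    rw [this, norm_smul, Real.norm_of_nonneg (by linarith)]
    nlinarith [norm_nonneg w]
  have hsplit : T (diagTwo 1 ((1 - t) • w + t • w')) -
      ((1 - t) • T (diagTwo 1 w) + t • T (diagTwo 1 w')) =
      (T (diagTwo 1 ((1 - t) • w + t • w')) - T (diagTwo 1 ((1 - t) • (r • w) + t • w'))) -
      (1 - t) • (T (diagTwo 1 w) - T (diagTwo 1 (r • w))) := by
    rw [interior hrw hw']
    module
  have hsub : (1 - t) • w + t • w' - ((1 - t) • (r • w) + t • w') = (1 - t) • (w - r • w) := by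
    module
  rw [hsplit, zero_add]
  refine (norm_sub_le _ _).trans ?_
  rw [hT.norm_sub _ _ (norm_diagTwo_one (convex_le hw hw'))
      (norm_diagTwo_one (convex_le hrw.le hw')), norm_smul,
    hT.norm_sub _ _ (norm_diagTwo_one hw) (norm_diagTwo_one hrw.le), diagTwo_sub, diagTwo_sub,
    norm_diagTwo_zero, norm_diagTwo_zero, hsub, norm_smul, Real.norm_of_nonneg (by linarith)]
  nlinarith [norm_nonneg (w - r • w)]

theorem exists_support_functional (hT : IsSphereIsometry T) :
    ∃ φ : StrongDual ℝ Y, ‖φ‖ = 1 ∧ ∀ w : 𝔽, ‖w‖ ≤ 1 → φ (T (diagTwo 1 w)) = 1 := by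
  have hn : ‖T (diagTwo 1 (0 : 𝔽))‖ = 1 := hT.norm_map _ (norm_diagTwo_one (by simp))
  obtain ⟨φ, hφ, hφe⟩ := exists_dual_vector ℝ (T (diagTwo 1 (0 : 𝔽)))
    (hn ▸ one_ne_zero)
  rw [hn] at hφe
  have hle (w : 𝔽) (hw : ‖w‖ ≤ 1) : φ (T (diagTwo 1 w)) ≤ 1 := by
    have := (le_abs_self _).trans (φ.le_opNorm (T (diagTwo 1 w)))
    rwa [hφ, hT.norm_map _ (norm_diagTwo_one hw), one_mul] at this
  refine ⟨φ, hφ, fun w hw => le_antisymm (hle w hw) ?_⟩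
  have hw' : ‖-w‖ ≤ 1 := by rwa [norm_neg]
  have h := congrArg φ (hT.map_diagTwo_convex hw hw' (t := 1 / 2) (by norm_num) (by norm_num))
  have h0 : (1 - 1 / 2 : ℝ) • w + (1 / 2 : ℝ) • -w = 0 := by module
  rw [h0, hφe, map_add, map_smul, map_smul] at h
  have := hle _ hw'
  simp at h
  linarith

theorem inner_le_support_functional (hT : IsSphereIsometry T) {φ : StrongDual ℝ Y} (hφ : ‖φ‖ = 1)
    (hφT : ∀ w : 𝔽, ‖w‖ ≤ 1 → φ (T (diagTwo 1 w)) = 1) {z : Matrix (Fin 2) (Fin 2) 𝔽}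
    (hz : IsIsometricMatrix z) : inner ℝ 1 (z 0 0) ≤ φ (T z) := by
  have neg_face (ω : 𝔽) (hω : ‖ω‖ ≤ 1) : φ (T (diagTwo (-1) ω)) = -1 := by
    have : diagTwo (-1) ω = -diagTwo 1 (-ω) := by simp [diagTwo]
    rw [this, hT.map_neg (norm_diagTwo_one (by rwa [norm_neg])), _root_.map_neg,
      hφT _ (by rwa [norm_neg])]
  by_cases h : z 0 0 = -1
  · have h1 := eq_diagTwo_of_entry_eq_one (b := -z) (by rw [norm_neg, hz.norm_eq_one])
      (by rw [Matrix.neg_apply, h, neg_neg])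
    have h2 : z = diagTwo (-1) (z 1 1) := by
      rw [← neg_inj, h1]
      simp [diagTwo]
    rw [h2, neg_face _ ((norm_entry_le z 1 1).trans hz.norm_eq_one.le)]
    simp [diagTwo]
  obtain ⟨ω, hω, η, hη, hcommon⟩ := hz.exists_common_vector h
  obtain ⟨Φ, hΦ, -⟩ := exists_face_equiv hη (by rw [hz, hη] : ‖matrixOp z η‖ = 1)
  obtain ⟨w, hw, hΦw⟩ := hΦ z hz.norm_eq_one rfl
  obtain ⟨w', hw', hΦw'⟩ := hΦ (diagTwo (-1) ω)
    (isIsometricMatrix_diagTwo (by simp) hω).norm_eq_one hcommon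
  set p := φ (T z)
  set α : ℝ := inner ℝ 1 (z 0 0)
  have hα1 : |α| ≤ 1 := by
    have := abs_real_inner_le_norm 1 (z 0 0)
    rw [norm_one, one_mul] at this
    exact this.trans ((norm_entry_le z 0 0).trans hz.norm_eq_one.le)
  have hp1 : |p| ≤ 1 := by
    have := φ.le_opNorm (T z)
    rwa [hφ, hT.norm_map _ hz.norm_eq_one, one_mul] at this
  have estimate (t : ℝ) (ht0 : 0 ≤ t) (ht1 : t ≤ 1 / 4) :
      (2 - t - t * p) ^ 2 ≤ (2 - t - t * α) ^ 2 + 3 * t ^ 2 := by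
    have hx := (hT.comp_equiv Φ).map_diagTwo_convex hw' hw ht0 (by linarith)
    have hnx : ‖Φ (diagTwo 1 ((1 - t) • w' + t • w))‖ = 1 := by
      rw [Φ.norm_map, norm_diagTwo_one]
      refine (norm_add_le _ _).trans ?_
      rw [norm_smul, norm_smul, Real.norm_of_nonneg ht0, Real.norm_of_nonneg (by linarith)]
      nlinarith
    have hny : ‖(1 - t) • ω‖ ≤ 1 := by
      rw [norm_smul, hω, Real.norm_of_nonneg (by linarith)]
      linarith
    have hdist := hT.norm_sub _ _ (norm_diagTwo_one hny) hnx
    have hval : φ (T (diagTwo 1 ((1 - t) • ω)) - T (Φ (diagTwo 1 ((1 - t) • w' + t • w)))) =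
        2 - t - t * p := by
      simp only [Function.comp_apply] at hx
      rw [hx, hΦw, hΦw', map_sub, map_add, map_smul, map_smul, neg_face ω hω.le, hφT _ hny]
      simp only [smul_eq_mul, p]
      ring
    have hmat : diagTwo 1 ((1 - t) • ω) - Φ (diagTwo 1 ((1 - t) • w' + t • w)) =
        (2 - t) • diagTwo 1 0 - t • z := by
      rw [diagTwo_convex, map_add, map_smul, map_smul, hΦw, hΦw', ← sub_sub]
      congr 1
      ext i j
      fin_cases i <;> fin_cases j <;> simp [diagTwo]
      module
    have hbound := φ.le_opNorm
      (T (diagTwo 1 ((1 - t) • ω)) - T (Φ (diagTwo 1 ((1 - t) • w' + t • w))))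
    rw [hval, hφ, one_mul, hdist, hmat, Real.norm_eq_abs] at hbound
    refine le_trans ?_ (hz.norm_sq_smul_sub_le ht0 (by linarith))
    rw [← sq_abs]
    gcongr
  rw [abs_le] at hα1 hp1
  refine le_of_forall_pos_le_add fun ε hε => ?_
  set t := min (1 / 4) (ε / 3)
  have ht0 : 0 < t := lt_min (by norm_num) (by positivity)
  have ht1 : t ≤ 1 / 4 := min_le_left _ _
  have ht2 : t ≤ ε / 3 := min_le_right _ _
  have h1 := estimate t ht0.le ht1
  by_contra! hlt
  have h2 : t * ((α - p) * (4 - 2 * t - t * (p + α))) ≤ t * (3 * t) := by nlinarith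
  have h3 := le_of_mul_le_mul_left h2 ht0
  have h4 : 1 ≤ 4 - 2 * t - t * (p + α) := by nlinarith
  nlinarith

theorem support_functional_eq_inner (hT : IsSphereIsometry T) {φ : StrongDual ℝ Y} (hφ : ‖φ‖ = 1)
    (hφT : ∀ w : 𝔽, ‖w‖ ≤ 1 → φ (T (diagTwo 1 w)) = 1) {x : Matrix (Fin 2) (Fin 2) 𝔽}
    (hx : ‖x‖ = 1) : φ (T x) = inner ℝ 1 (x 0 0) := by
  have unitary {z : Matrix (Fin 2) (Fin 2) 𝔽} (hz : IsIsometricMatrix z) :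
      φ (T z) = inner ℝ 1 (z 0 0) := by
    have h := hT.inner_le_support_functional hφ hφT (z := -z) fun v => by
      rw [_root_.map_neg, _root_.neg_apply, norm_neg, hz]
    rw [hT.map_neg hz.norm_eq_one, _root_.map_neg, Matrix.neg_apply, inner_neg_right] at h
    exact le_antisymm (neg_le_neg_iff.1 h) (hT.inner_le_support_functional hφ hφT hz)
  obtain ⟨Φ, ⟨w, hw, rfl⟩, hΦ⟩ := exists_face_equiv_of_norm_eq_one hx
  obtain ⟨v, hv, hwv⟩ := exists_norm_eq_one_smul w
  have hv' : ‖-v‖ = 1 := by rwa [norm_neg]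
  set t := (1 + ‖w‖) / 2
  have hconv : w = (1 - t) • -v + t • v := by
    rw [hwv]
    simp only [t]
    module
  have ht0 : 0 ≤ t := by positivity
  have ht1 : t ≤ 1 := by
    simp only [t]
    linarith
  have h := congrArg φ ((hT.comp_equiv Φ).map_diagTwo_convex hv'.le hv.le ht0 ht1)
  simp only [Function.comp_apply, ← hconv, map_add, map_smul] at h
  rw [h, unitary (hΦ _ (isIsometricMatrix_diagTwo norm_one hv)),
    unitary (hΦ _ (isIsometricMatrix_diagTwo norm_one hv')), hconv, diagTwo_convex, map_add,
    map_smul, map_smul]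
  simp [inner_add_right, real_inner_smul_right]

/-- A surjective isometry of the unit sphere of `M₂(𝔽)` onto that of a real normed space extends
to a real linear isometry. -/
theorem exists_linear_extension (hT : IsSphereIsometry T) :
    ∃ g : Matrix (Fin 2) (Fin 2) 𝔽 →ₗ[ℝ] Y,
      (∀ x, ‖g x‖ = ‖x‖) ∧ ∀ x, ‖x‖ = 1 → g x = T x := by
  let G (x : Matrix (Fin 2) (Fin 2) 𝔽) : Y := ‖x‖ • T (‖x‖⁻¹ • x)
  have separation (m : Y) (h : ∀ (φ : StrongDual ℝ Y) (ρ : Matrix (Fin 2) (Fin 2) 𝔽 →ₗ[ℝ] ℝ),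
      (∀ x, φ (G x) = ρ x) → φ m = 0) : m = 0 := by
    by_contra hm
    obtain ⟨c, hc, hTc⟩ := hT.surj (‖m‖⁻¹ • m) (norm_smul_inv_norm hm)
    obtain ⟨Φ, ⟨w, hw, hΦw⟩, -⟩ := exists_face_equiv_of_norm_eq_one hc
    obtain ⟨φ, hφ, hφT⟩ := (hT.comp_equiv Φ).exists_support_functional
    have h0 := h φ (innerₗ 𝔽 1 ∘ₗ Matrix.entryLinearMap ℝ 𝔽 0 0 ∘ₗ Φ.symm.toLinearMap) fun x => by
      by_cases hx : x = 0
      · simp [G, hx]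
      have hx1 : ‖Φ.symm (‖x‖⁻¹ • x)‖ = 1 := by
        rw [Φ.symm.norm_map]
        exact norm_smul_inv_norm hx
      have := (hT.comp_equiv Φ).support_functional_eq_inner hφ hφT hx1
      rw [Function.comp_apply, Φ.apply_symm_apply, map_smul, Matrix.smul_apply,
        real_inner_smul_right] at this
      simp only [G, map_smul, this, smul_eq_mul]
      rw [mul_inv_cancel_left₀ (norm_ne_zero_iff.2 hx)]
      rfl
    have h1 := hφT w hw
    rw [Function.comp_apply, hΦw, hTc, map_smul, h0, smul_zero] at h1
    exact zero_ne_one h1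
  refine ⟨{ toFun := G, map_add' := fun x y => ?_, map_smul' := fun r x => ?_ },
    fun x => ?_, fun x hx => ?_⟩
  · rw [← sub_eq_zero]
    refine separation _ fun φ ρ hρ => ?_
    rw [map_sub, map_add, hρ, hρ, hρ, map_add, sub_self]
  · rw [← sub_eq_zero]
    refine separation _ fun φ ρ hρ => ?_
    rw [map_sub, hρ, RingHom.id_apply, φ.map_smul, hρ, map_smul, sub_self]
  · by_cases hx : x = 0
    · simp [G, hx]
    · have hx1 : ‖‖x‖⁻¹ • x‖ = 1 := norm_smul_inv_norm hx
      change ‖‖x‖ • T (‖x‖⁻¹ • x)‖ = ‖x‖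
      rw [norm_smul, hT.norm_map _ hx1, norm_norm, mul_one]
  · change ‖x‖ • T (‖x‖⁻¹ • x) = T x
    rw [hx, inv_one, one_smul, one_smul]

end IsSphereIsometry

theorem exists_linear_extension_of_opN {Y : Type*} [NormedAddCommGroup Y] [NormedSpace ℝ Y]
    (T : Matrix (Fin 2) (Fin 2) 𝔽 → Y)
    (hT : ∀ x y, opN 𝔽 x = 1 → opN 𝔽 y = 1 → ‖T x - T y‖ = opN 𝔽 (x - y))
    (hsurj : T '' {x | opN 𝔽 x = 1} = Metric.sphere (0 : Y) 1) :
    ∃ g : Matrix (Fin 2) (Fin 2) 𝔽 →ₗ[ℝ] Y,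
      (∀ a, ‖g a‖ = opN 𝔽 a) ∧ ∀ a, opN 𝔽 a = 1 → g a = T a := by
  simp only [opN_eq_norm_matrixOp, ← norm_eq_norm_matrixOp] at hT hsurj ⊢
  have hT' : IsSphereIsometry T :=
    { norm_sub := hT
      norm_map := fun x hx => mem_sphere_zero_iff_norm.1 (hsurj ▸ Set.mem_image_of_mem T hx)
      surj := fun y hy => by
        have : y ∈ T '' {x | ‖x‖ = 1} := hsurj ▸ mem_sphere_zero_iff_norm.2 hy
        exact this }
  exact hT'.exists_linear_extension

end OperatorNorm

/-- Let `A = M₂(𝔽)` with `𝔽 ∈ {ℝ, ℂ, ℍ}`, endowed with the operator norm, `Y` a real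
normed space, and `T : S_A → S_Y` a surjective isometry. Then the restriction of `T` to
`S_A ∩ A_sa` admits a real linear isometric extension defined on the self-adjoint part. -/
theorem m2_selfAdjoint_linear_extension :
    SelfAdjointPartLinearExtension ℝ ∧
    SelfAdjointPartLinearExtension ℂ ∧
    SelfAdjointPartLinearExtension (Quaternion ℝ) := by
  refine ⟨fun Y _ _ T hT hsurj => ?_, fun Y _ _ T hT hsurj => ?_, fun Y _ _ T hT hsurj => ?_⟩
  all_goals
    obtain ⟨g, hg, hgT⟩ := exists_linear_extension_of_opN T hT hsurj
    exact ⟨g, fun a _ => hg a, fun a _ => hgT a⟩
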